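/- Let n ≥ 1 and m < 0, and let v₀ : ℝⁿ → ℝ be continuous and everywhere positive with 1/v₀ bounded on ℝⁿ. Then every global positive classical solution v of the Cauchy problem (F) with initial data v₀ satisfies t^{−1/(1−m)} v(·,t) → 0 in L^∞_loc(ℝⁿ) as t → ∞; that is, for every R > 0, sup_{|x|≤R} t^{−1/(1−m)} v(x,t) → 0 as t → ∞. -/

import Mathlib

open MeasureTheory
open scoped ENNReal
noncomputable section

abbrev Euc (n : ℕ) := EuclideanSpace ℝ (Fin n)

/-- The divergence (in the spatial variables) of a vector field `F : ℝⁿ → ℝⁿ`. -/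
def divg (n : ℕ) (F : Euc n → Euc n) (x : Euc n) : ℝ :=
  ∑ i : Fin n, fderiv ℝ F x (EuclideanSpace.single i 1) i

/-- `IsSolF n m v₀ v T` means: `v` is a classical solution of the Cauchy problem (F):
`∂ₜ v = ∇·(v^{m-1} ∇v)` on `ℝⁿ × (0,T)`, `v(·,0) = v₀`, belonging to
`C⁰(ℝⁿ × [0,T)) ∩ C^{2,1}(ℝⁿ × (0,T))`.  Here `T ∈ (0,∞]` is encoded as `T : ℝ≥0∞`. -/
structure IsSolF (n : ℕ) (m : ℝ) (v₀ : Euc n → ℝ) (v : Euc n → ℝ → ℝ) (T : ℝ≥0∞) : Prop where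
  cont : ContinuousOn (fun q : Euc n × ℝ => v q.1 q.2) {q | 0 ≤ q.2 ∧ ENNReal.ofReal q.2 < T}
  init : ∀ x, v x 0 = v₀ x
  reg_space : ∀ t : ℝ, 0 < t → ENNReal.ofReal t < T → ContDiff ℝ 2 fun x => v x t
  reg_time : ∀ x, ∀ t : ℝ, 0 < t → ENNReal.ofReal t < T → DifferentiableAt ℝ (v x) t
  pde : ∀ x, ∀ t : ℝ, 0 < t → ENNReal.ofReal t < T →
    deriv (v x) t =
      divg n (fun y => v y t ^ (m - 1) • gradient (fun z => v z t) y) x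

/-- `v` is positive on `ℝⁿ × [0,T)`. -/
def PosOn (n : ℕ) (v : Euc n → ℝ → ℝ) (T : ℝ≥0∞) : Prop :=
  ∀ x : Euc n, ∀ t : ℝ, 0 ≤ t → ENNReal.ofReal t < T → 0 < v x t

/-- `v` is the maximal global positive classical solution of (F) with initial data `v₀`:
it is a global positive classical solution and lies above every positive classical solution
with the same initial data on its interval of existence `[0,T)`, `T ∈ (0,∞]`. -/
def IsMaxSolF (n : ℕ) (m : ℝ) (v₀ : Euc n → ℝ) (v : Euc n → ℝ → ℝ) : Prop :=
  IsSolF n m v₀ v ⊤ ∧ PosOn n v ⊤ ∧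
    ∀ T : ℝ≥0∞, 0 < T → ∀ w : Euc n → ℝ → ℝ, IsSolF n m v₀ w T → PosOn n w T →
      ∀ x : Euc n, ∀ t : ℝ, 0 ≤ t → ENNReal.ofReal t < T → w x t ≤ v x t

open Filter Topology in
lemma IsLocalMin.second_deriv_nonneg {f f' : ℝ → ℝ} {c x : ℝ}
    (hmin : IsLocalMin f x) (hf : ∀ s, HasDerivAt f (f' s) s) (hf' : HasDerivAt f' c x) :
    0 ≤ c := by
  by_contra! hc
  have hderiv : deriv f = f' := funext fun s => (hf s).deriv
  have hmax : IsLocalMax f x := by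
    refine isLocalMax_of_deriv_deriv_neg ?_ hmin.deriv_eq_zero (hf x).continuousAt
    rwa [hderiv, hf'.deriv]
  have hconst : f =ᶠ[𝓝 x] fun _ => f x := by
    filter_upwards [hmin, hmax] with s h₁ h₂ using le_antisymm h₂ h₁
  have h : deriv (deriv f) x = 0 := by
    rw [hconst.deriv.deriv_eq]
    simp
  rw [hderiv, hf'.deriv] at h
  exact hc.ne h

open Filter Topology in
lemma HasDerivAt.nonpos_of_pos_left {f : ℝ → ℝ} {c a t : ℝ} (hf : HasDerivAt f c t)
    (ht : f t = 0) (hat : a < t) (hpos : ∀ s, a < s → s < t → 0 < f s) : c ≤ 0 := by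
  by_contra! hc
  have hsign := (eventually_nhdsWithin_sign_eq_of_deriv_pos (by rwa [hf.deriv]) ht).filter_mono
    (nhdsWithin_le_nhds (s := Set.Iio t))
  obtain ⟨s, hs, has, hst⟩ := (hsign.and (Ioo_mem_nhdsLT hat)).exists
  rw [sign_pos (hpos s has hst), sign_neg (sub_neg.2 hst)] at hs
  exact absurd hs (by decide)

lemma gradient_apply_eq_fderiv {n : ℕ} (u : Euc n → ℝ) (y : Euc n) (i : Fin n) :
    gradient u y i = fderiv ℝ u y (EuclideanSpace.single i 1) := by
  have h : inner ℝ (gradient u y) (EuclideanSpace.single i (1 : ℝ)) = gradient u y i := by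
    rw [EuclideanSpace.inner_single_right]
    simp
  rw [← h, ← toDual_gradient (𝕜 := ℝ), InnerProductSpace.toDual_apply_apply]

lemma norm_add_smul_single_sq {n : ℕ} (x : Euc n) (i : Fin n) (s : ℝ) :
    ‖x + s • EuclideanSpace.single i (1 : ℝ)‖ ^ 2 = ‖x‖ ^ 2 + 2 * s * x i + s ^ 2 := by
  rw [norm_add_sq_real, inner_smul_right, norm_smul]
  simp [EuclideanSpace.inner_single_right]
  ring

/-- At a local minimum of `u ^ m - b (Q - |x|²)` the elliptic operator is controlled by
that of the paraboloid. -/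
lemma divg_lower_bound {n : ℕ} {m b Q : ℝ} {u : Euc n → ℝ} {x : Euc n}
    (hu : ContDiff ℝ 2 u) (hpos : ∀ y, 0 < u y)
    (hmin : IsLocalMin (fun y => u y ^ m - b * (Q - ‖y‖ ^ 2)) x) :
    -(2 * n * b) ≤ m * divg n (fun y => u y ^ (m - 1) • gradient u y) x := by
  have hgrad : Differentiable ℝ (gradient u) := by
    have h₁ : ContDiff ℝ 1 (fderiv ℝ u) := hu.fderiv_right (by norm_num)
    exact (InnerProductSpace.toDual ℝ (Euc n)).symm.toContinuousLinearEquiv.differentiable.comp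
      (h₁.differentiable one_ne_zero)
  have hdiff : Differentiable ℝ u := hu.differentiable two_ne_zero
  set F : Euc n → Euc n := fun y => u y ^ (m - 1) • gradient u y with hF
  have hFd : Differentiable ℝ F := fun y =>
    ((hdiff y).rpow_const (Or.inl (hpos y).ne')).smul (hgrad y)
  have hterm : ∀ i : Fin n, -(2 * b) ≤ m * fderiv ℝ F x (EuclideanSpace.single i 1) i := by
    intro i
    set e : Euc n := EuclideanSpace.single i 1 with he
    have hline : ∀ s : ℝ, HasDerivAt (fun r : ℝ => x + r • e) e s := fun s => by
      simpa using ((hasDerivAt_id s).smul_const e).const_add x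
    have hmin' : IsLocalMin
        (fun s : ℝ => u (x + s • e) ^ m - b * (Q - ‖x + s • e‖ ^ 2)) 0 := by
      have hcont : ContinuousAt (fun r : ℝ => x + r • e) 0 := (hline 0).continuousAt
      have hmin₀ : IsLocalMin (fun y => u y ^ m - b * (Q - ‖y‖ ^ 2)) (x + (0 : ℝ) • e) := by
        simpa using hmin
      exact IsLocalMin.comp_continuous (g := fun r : ℝ => x + r • e) hmin₀ hcont
    have hfirst : ∀ s : ℝ, HasDerivAt
        (fun s : ℝ => u (x + s • e) ^ m - b * (Q - ‖x + s • e‖ ^ 2))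
        (m * F (x + s • e) i + b * (2 * x i + 2 * s)) s := by
      intro s
      have h₁ : HasDerivAt (fun r : ℝ => u (x + r • e)) (fderiv ℝ u (x + s • e) e) s :=
        (hdiff (x + s • e)).hasFDerivAt.comp_hasDerivAt s (hline s)
      have h₂ := h₁.rpow_const (p := m) (Or.inl (hpos (x + s • e)).ne')
      have h₃ : HasDerivAt (fun r : ℝ => b * (Q - ‖x + r • e‖ ^ 2))
          (-(b * (2 * x i + 2 * s))) s := by
        simp_rw [he, norm_add_smul_single_sq]
        have h₄ := ((((((hasDerivAt_id s).const_mul 2).mul_const (x i)).const_add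
          (‖x‖ ^ 2)).add ((hasDerivAt_id s).pow 2)).const_sub Q).const_mul b
        refine h₄.congr_deriv ?_
        simp
        ring
      refine (h₂.sub h₃).congr_deriv ?_
      rw [hF]
      simp only [PiLp.smul_apply, smul_eq_mul, gradient_apply_eq_fderiv]
      ring
    have hsecond : HasDerivAt (fun s : ℝ => m * F (x + s • e) i + b * (2 * x i + 2 * s))
        (m * fderiv ℝ F x e i + 2 * b) 0 := by
      have h₀ : HasFDerivAt F (fderiv ℝ F x) (x + (0 : ℝ) • e) := by
        simpa using (hFd x).hasFDerivAt
      have h₁ : HasDerivAt (fun r : ℝ => F (x + r • e)) (fderiv ℝ F x e) 0 :=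
        HasFDerivAt.comp_hasDerivAt (f := fun r : ℝ => x + r • e) 0 h₀ (hline 0)
      have h₂ : HasDerivAt (fun r : ℝ => F (x + r • e) i) (fderiv ℝ F x e i) 0 :=
        (EuclideanSpace.proj (𝕜 := ℝ) i).hasFDerivAt.comp_hasDerivAt 0 h₁
      refine ((h₂.const_mul m).add
        ((((hasDerivAt_id (0 : ℝ)).const_mul 2).const_add (2 * x i)).const_mul b)).congr_deriv ?_
      ring
    linarith [hmin'.second_deriv_nonneg hfirst hsecond]
  have hsum := Finset.sum_le_sum fun i (_ : i ∈ Finset.univ) => hterm i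
  rw [Finset.sum_const, Finset.card_univ, Fintype.card_fin, nsmul_eq_mul,
    ← Finset.mul_sum] at hsum
  rw [divg]
  linarith

open Filter Topology in
/-- Comparison of `v ^ m` with the separated barrier `A (t + τ)^{-k} (Q - |x|²)`,
`k = m / (m - 1)`, on the ball `|x|² ≤ Q`. -/
lemma barrier_lt_rpow {n : ℕ} {m : ℝ} (hm : m < 0) {v₀ : Euc n → ℝ} {v : Euc n → ℝ → ℝ}
    (hv : IsSolF n m v₀ v ⊤) (hvpos : PosOn n v ⊤) {A Q τ k : ℝ} (hA : 0 < A)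
    (hτ : 0 < τ) (hk : k = m / (m - 1))
    (hAQ : 2 * n * (A ^ k⁻¹ * Q ^ (k⁻¹ - 1)) < k)
    (hinit : ∀ x, ‖x‖ ^ 2 ≤ Q → A * τ ^ (-k) * (Q - ‖x‖ ^ 2) < v x 0 ^ m) :
    ∀ x t, ‖x‖ ^ 2 ≤ Q → 0 ≤ t → A * (t + τ) ^ (-k) * (Q - ‖x‖ ^ 2) < v x t ^ m := by
  have hpos : ∀ x t, 0 ≤ t → 0 < v x t := fun x t ht => hvpos x t ht ENNReal.ofReal_lt_top
  have hk0 : 0 < k := hk ▸ div_pos_of_neg_of_neg hm (by linarith)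
  have hk1 : k < 1 := by rw [hk, div_lt_one_of_neg (by linarith)]; linarith
  have hp1 : 1 < k⁻¹ := (one_lt_inv₀ hk0).2 hk1
  have hmk : m * k⁻¹ = m - 1 := by
    rw [hk, inv_div, mul_div_cancel₀ _ hm.ne]
  intro x₁ t₁ hx₁ ht₁
  by_contra! hcon
  set G : Euc n × ℝ → ℝ :=
    fun q => v q.1 q.2 ^ m - A * (q.2 + τ) ^ (-k) * (Q - ‖q.1‖ ^ 2) with hG
  set K : Set (Euc n × ℝ) := {x | ‖x‖ ^ 2 ≤ Q} ×ˢ Set.Icc 0 t₁ with hK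
  have hball : IsCompact {x : Euc n | ‖x‖ ^ 2 ≤ Q} := by
    refine (isCompact_closedBall (0 : Euc n) (√Q)).of_isClosed_subset
      (isClosed_le (by fun_prop) continuous_const) fun y hy => ?_
    simpa using Real.le_sqrt_of_sq_le hy
  have hKc : IsCompact K := hball.prod isCompact_Icc
  have hGcont : ContinuousOn G {q | 0 ≤ q.2} := by
    have hvc : ContinuousOn (fun q : Euc n × ℝ => v q.1 q.2) {q | 0 ≤ q.2} :=
      hv.cont.mono fun q hq => ⟨hq, ENNReal.ofReal_lt_top⟩
    refine (hvc.rpow_const fun q hq => Or.inl (hpos q.1 q.2 hq).ne').sub ?_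
    refine (continuousOn_const.mul (ContinuousOn.rpow_const (by fun_prop) fun q hq => Or.inl ?_)).mul
      (by fun_prop)
    have : 0 ≤ q.2 := hq
    positivity
  have hGK : ContinuousOn G K := hGcont.mono fun q hq => hq.2.1
  have hSc : IsCompact (K ∩ G ⁻¹' Set.Iic 0) :=
    hKc.of_isClosed_subset (hGK.preimage_isClosed_of_isClosed hKc.isClosed isClosed_Iic)
      Set.inter_subset_left
  obtain ⟨⟨x, t⟩, ⟨⟨hxQ, ht0, htt₁⟩, hGle⟩, hfirst⟩ :=
    hSc.exists_isMinOn ⟨(x₁, t₁), ⟨hx₁, ht₁, le_rfl⟩, sub_nonpos.2 hcon⟩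
      continuous_snd.continuousOn
  simp only [Set.mem_ofPred_eq, Set.mem_preimage, Set.mem_Iic] at hxQ ht0 htt₁ hGle
  have hbefore : ∀ y s, ‖y‖ ^ 2 ≤ Q → 0 ≤ s → s < t → 0 < G (y, s) := by
    intro y s hy hs hst
    by_contra! h
    have hmem : (y, s) ∈ K ∩ G ⁻¹' Set.Iic 0 := ⟨⟨hy, hs, hst.le.trans htt₁⟩, h⟩
    exact hst.not_ge (isMinOn_iff.1 hfirst (y, s) hmem)
  have ht : 0 < t := by
    rcases ht0.eq_or_lt with rfl | h
    · have := hinit x hxQ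
      simp only [hG, zero_add] at hGle
      linarith
    · exact h
  have hnonneg : ∀ y, ‖y‖ ^ 2 ≤ Q → 0 ≤ G (y, t) := by
    intro y hy
    have hc : ContinuousAt (fun s => G (y, s)) t := by
      have : ContinuousOn (fun s => G (y, s)) (Set.Ici 0) :=
        hGcont.comp (by fun_prop) fun s hs => hs
      exact this.continuousAt (Ici_mem_nhds ht)
    refine ge_of_tendsto (hc.tendsto.mono_left (nhdsWithin_le_nhds (s := Set.Iio t))) ?_
    filter_upwards [Ioo_mem_nhdsLT ht] with s hs
    exact (hbefore y s hy hs.1.le hs.2).le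
  have hzero : G (x, t) = 0 := le_antisymm hGle (hnonneg x hxQ)
  have htτ : 0 < t + τ := by linarith
  have hvx := hpos x t ht.le
  set b := A * (t + τ) ^ (-k) with hb
  have hbpos : 0 < b := by positivity
  have heq : v x t ^ m = b * (Q - ‖x‖ ^ 2) := sub_eq_zero.1 hzero
  have hρ : 0 < Q - ‖x‖ ^ 2 := by
    have := Real.rpow_pos_of_pos hvx m
    rw [heq] at this
    exact pos_of_mul_pos_right this hbpos.le
  set ρ := Q - ‖x‖ ^ 2 with hρdef
  have hmin : IsLocalMin (fun y => v y t ^ m - b * (Q - ‖y‖ ^ 2)) x := by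
    have hnear : ∀ᶠ y in 𝓝 x, ‖y‖ ^ 2 < Q :=
      ContinuousAt.eventually_lt (by fun_prop) continuousAt_const (sub_pos.1 hρ)
    filter_upwards [hnear] with y hy
    exact hzero.le.trans (hnonneg y hy.le)
  have hspace := divg_lower_bound (hv.reg_space t ht ENNReal.ofReal_lt_top)
    (fun y => hpos y t ht.le) hmin
  rw [← hv.pde x t ht ENNReal.ofReal_lt_top] at hspace
  have htime : HasDerivAt (fun s => G (x, s))
      (deriv (v x) t * m * v x t ^ (m - 1) - A * (1 * -k * (t + τ) ^ (-k - 1)) * ρ) t := by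
    have h₁ := (hv.reg_time x t ht ENNReal.ofReal_lt_top).hasDerivAt.rpow_const
      (p := m) (Or.inl hvx.ne')
    have h₂ := ((((hasDerivAt_id t).add_const τ).rpow_const
      (p := -k) (Or.inl htτ.ne')).const_mul A).mul_const ρ
    exact h₁.sub h₂
  have hle := htime.nonpos_of_pos_left hzero ht fun s hs hst => hbefore x s hxQ hs.le hst
  have hpow : v x t ^ (m - 1) = A ^ k⁻¹ * (t + τ)⁻¹ * (ρ ^ (k⁻¹ - 1) * ρ) := by
    rw [← hmk, Real.rpow_mul hvx.le, heq, hb, Real.mul_rpow (by positivity) hρ.le,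
      Real.mul_rpow hA.le (by positivity), ← Real.rpow_mul htτ.le, neg_mul,
      mul_inv_cancel₀ hk0.ne', Real.rpow_neg_one, ← Real.rpow_add_one hρ.ne', sub_add_cancel]
  have hρpow : ρ ^ (k⁻¹ - 1) ≤ Q ^ (k⁻¹ - 1) :=
    Real.rpow_le_rpow hρ.le (by rw [hρdef]; linarith [sq_nonneg ‖x‖]) (by linarith)
  have hstrict : 2 * n * (A ^ k⁻¹ * ρ ^ (k⁻¹ - 1)) < k := lt_of_le_of_lt (by gcongr) hAQ
  have hshift : (t + τ) ^ (-k - 1) = (t + τ) ^ (-k) * (t + τ)⁻¹ := by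
    rw [Real.rpow_sub_one htτ.ne', div_eq_mul_inv]
  have hw : 0 < v x t ^ (m - 1) := Real.rpow_pos_of_pos hvx _
  have h₁ : -(2 * n * b) * v x t ^ (m - 1) ≤ m * deriv (v x) t * v x t ^ (m - 1) :=
    mul_le_mul_of_nonneg_right hspace hw.le
  have h₂ : A * (1 * -k * (t + τ) ^ (-k - 1)) * ρ = -(k * (b * (t + τ)⁻¹ * ρ)) := by
    rw [hshift, hb]; ring
  have h₃ : -(2 * n * b) * v x t ^ (m - 1) =
      -(2 * n * (A ^ k⁻¹ * ρ ^ (k⁻¹ - 1)) * (b * (t + τ)⁻¹ * ρ)) := by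
    rw [hpow]; ring
  have h₄ := mul_lt_mul_of_pos_right hstrict
    (show 0 < b * (t + τ)⁻¹ * ρ by positivity)
  rw [h₂] at hle
  rw [h₃] at h₁
  linarith

/-- Theorem: if `1/v₀` is bounded then every global positive classical solution of (F)
satisfies `t^{-1/(1-m)} v(·,t) → 0` in `L^∞_loc(ℝⁿ)` as `t → ∞`. -/
theorem stmt10 (n : ℕ) (hn : 1 ≤ n) (m : ℝ) (hm : m < 0)
    (v₀ : Euc n → ℝ) (hcont : Continuous v₀) (hpos : ∀ x, 0 < v₀ x)
    (hbdd : BddAbove (Set.range fun x => (v₀ x)⁻¹))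
    (v : Euc n → ℝ → ℝ) (hv : IsSolF n m v₀ v ⊤) (hvpos : PosOn n v ⊤) :
    ∀ R : ℝ, 0 < R → ∀ ε : ℝ, 0 < ε → ∃ T : ℝ, 0 < T ∧
      ∀ t : ℝ, T ≤ t → ∀ x : Euc n, ‖x‖ ≤ R →
        t ^ (-(1 / (1 - m))) * v x t < ε := by
  intro R₀ hR₀ ε hε
  have hvpos' : ∀ x t, 0 ≤ t → 0 < v x t := fun x t ht => hvpos x t ht ENNReal.ofReal_lt_top
  obtain ⟨k, hk⟩ : ∃ k, k = m / (m - 1) := ⟨_, rfl⟩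
  have hk0 : 0 < k := hk ▸ div_pos_of_neg_of_neg hm (by linarith)
  have hn0 : (0 : ℝ) < n := by exact_mod_cast hn
  have hθ : (1 / (1 - m)) * m = -k := by
    rw [hk, ← neg_sub m 1, div_neg]
    ring
  set a : ℝ := (k / (4 * n)) ^ k with ha
  have ha0 : 0 < a := by positivity
  obtain ⟨Q, hQε, hQR⟩ : ∃ Q : ℝ, ε ^ m * 2 ^ k * 2 / a ≤ Q ^ k ∧ 2 * R₀ ^ 2 ≤ Q :=
    (((tendsto_rpow_atTop hk0).eventually_ge_atTop _).and (Filter.eventually_ge_atTop _)).exists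
  have hQ : 0 < Q := lt_of_lt_of_le (by positivity) hQR
  set A : ℝ := a * Q ^ (k - 1) with hA
  have hA0 : 0 < A := by positivity
  have hAQ : 2 * n * (A ^ k⁻¹ * Q ^ (k⁻¹ - 1)) < k := by
    have h₁ : A ^ k⁻¹ * Q ^ (k⁻¹ - 1) = k / (4 * n) := by
      rw [hA, Real.mul_rpow ha0.le (by positivity), ha, Real.rpow_rpow_inv (by positivity) hk0.ne',
        ← Real.rpow_mul hQ.le, mul_assoc, ← Real.rpow_add hQ]
      have : (k - 1) * k⁻¹ + (k⁻¹ - 1) = 0 := by field_simp; ring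
      rw [this, Real.rpow_zero, mul_one]
    rw [h₁]
    field_simp
    linarith
  obtain ⟨τ, hτ, hinit⟩ : ∃ τ : ℝ, 0 < τ ∧
      ∀ x : Euc n, ‖x‖ ^ 2 ≤ Q → A * τ ^ (-k) * (Q - ‖x‖ ^ 2) < v x 0 ^ m := by
    have hball : IsCompact (Metric.closedBall (0 : Euc n) (√Q)) := isCompact_closedBall _ _
    have hc : Continuous fun x => v₀ x ^ m := hcont.rpow_const fun x => Or.inl (hpos x).ne'
    obtain ⟨x₀, -, hx₀⟩ := hball.exists_isMinOn ⟨0, by simp⟩ hc.continuousOn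
    have hlim : Filter.Tendsto (fun τ : ℝ => A * τ ^ (-k) * Q) Filter.atTop (nhds 0) := by
      simpa using ((tendsto_rpow_neg_atTop hk0).const_mul A).mul_const Q
    obtain ⟨τ, hτlt, hτ⟩ := ((hlim.eventually_lt_const (Real.rpow_pos_of_pos (hpos x₀) m)).and
      (Filter.eventually_gt_atTop 0)).exists
    refine ⟨τ, hτ, fun x hx => ?_⟩
    rw [hv.init]
    have hx' : x ∈ Metric.closedBall (0 : Euc n) (√Q) := by
      simpa using Real.le_sqrt_of_sq_le hx
    calc A * τ ^ (-k) * (Q - ‖x‖ ^ 2) ≤ A * τ ^ (-k) * Q := by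
          gcongr
          linarith [sq_nonneg ‖x‖]
      _ < v₀ x₀ ^ m := hτlt
      _ ≤ v₀ x ^ m := hx₀ hx'
  refine ⟨τ, hτ, fun t ht x hx => ?_⟩
  have ht0 : 0 < t := hτ.trans_le ht
  have hxR : ‖x‖ ^ 2 ≤ R₀ ^ 2 := by gcongr
  have hcmp := barrier_lt_rpow hm hv hvpos hA0 hτ hk hAQ hinit x t
    (by nlinarith [sq_nonneg R₀]) ht0.le
  have hshift : (2 : ℝ) ^ (-k) * t ^ (-k) ≤ (t + τ) ^ (-k) := by
    rw [← Real.mul_rpow zero_le_two ht0.le]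
    exact Real.rpow_le_rpow_of_nonpos (by linarith) (by linarith) (by linarith)
  have hlower : ε ^ m * t ^ (-k) ≤ A * (t + τ) ^ (-k) * (Q - ‖x‖ ^ 2) := by
    calc ε ^ m * t ^ (-k) = (ε ^ m * 2 ^ k * 2 / a) * (a * (2 ^ (-k) * t ^ (-k)) / 2) := by
          rw [Real.rpow_neg zero_le_two]
          field_simp
      _ ≤ Q ^ k * (a * (2 ^ (-k) * t ^ (-k)) / 2) := by gcongr
      _ = A * (2 ^ (-k) * t ^ (-k)) * (Q / 2) := by
          rw [hA, Real.rpow_sub_one hQ.ne']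
          field_simp
      _ ≤ A * (t + τ) ^ (-k) * (Q - ‖x‖ ^ 2) := by
          gcongr
          linarith
  have hlt : (ε * t ^ (1 / (1 - m))) ^ m < v x t ^ m := by
    rw [Real.mul_rpow hε.le (by positivity), ← Real.rpow_mul ht0.le, hθ]
    exact hlower.trans_lt hcmp
  have hvlt : v x t < ε * t ^ (1 / (1 - m)) :=
    (Real.rpow_lt_rpow_iff_of_neg (by positivity) (hvpos' x t ht0.le) hm).1 hlt
  rw [Real.rpow_neg ht0.le, inv_mul_lt_iff₀ (by positivity), mul_comm]
  exact hvlt
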